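/- arXiv:1505.06581 — 6 statements merged into one kernel-verified Lean document; each statement's English description precedes it below -/
import Mathlib

section
/- For every n ≥ 1, the number of simple permutations of order 4n+2 is exactly 8n+4; that is, the cardinality of Sim(4n+2) equals 8n+4. -/
/-- Reversing of a permutation of `Fin m`: the 0-based version of
`α̃(k) = α(m+1−k)` on `{1,…,m}`. -/
def reversing {m : ℕ} (α : Equiv.Perm (Fin m)) : Equiv.Perm (Fin m) :=
  Fin.revPerm.trans α

/-- Right pasting `α⋄|β`: `(α⋄|β)(i) = α(i)` on the first block and
`(α⋄|β)(m+j) = β(j)+m` on the second block. -/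
def rpaste {m n : ℕ} (α : Equiv.Perm (Fin m)) (β : Equiv.Perm (Fin n)) :
    Equiv.Perm (Fin (m + n)) :=
  finSumFinEquiv.permCongr (Equiv.sumCongr α β)

/-- Left pasting `α|⋄β`: `(α|⋄β)(i) = α(i)+n` on the first block and
`(α|⋄β)(m+j) = β(j)` on the second block. -/
def lpaste {m n : ℕ} (α : Equiv.Perm (Fin m)) (β : Equiv.Perm (Fin n)) :
    Equiv.Perm (Fin (m + n)) :=
  finSumFinEquiv.symm.trans
    (((Equiv.sumCongr α β).trans (Equiv.sumComm (Fin m) (Fin n))).trans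
      (finSumFinEquiv.trans (finCongr (Nat.add_comm n m))))

/-- 0-based version of the Stefan permutation `α_{2n+1}`:
`α(i) = 2n+2−i` for `1 ≤ i ≤ n`, `α(i) = 2n+1−i` for `n+1 ≤ i ≤ 2n`,
`α(2n+1) = n+1` (1-based). -/
def stefanAlphaFun (n : ℕ) (i : ℕ) : ℕ :=
  if i < n then 2 * n - i else if i < 2 * n then 2 * n - 1 - i else n

/-- 0-based version of the Stefan permutation `β_{2n+1}`:
`β(1) = n+1`, `β(i) = 2n+3−i` for `2 ≤ i ≤ n+1`, `β(i) = 2n+2−i` for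
`n+2 ≤ i ≤ 2n+1` (1-based). -/
def stefanBetaFun (n : ℕ) (i : ℕ) : ℕ :=
  if i = 0 then n else if i ≤ n then 2 * n + 1 - i else 2 * n - i

/-- `θ ∈ Sim(4n+2)`: `θ` is a `(4n+2)`-cycle, `θ` interchanges the two blocks
`{1,…,2n+1}` and `{2n+2,…,4n+2}`, `θ²` preserves each block, and the
permutation induced by `θ²` on each block is `α_{2n+1}` or `β_{2n+1}`
(everything written 0-based). -/
def IsSim (n : ℕ) (θ : Equiv.Perm (Fin (4 * n + 2))) : Prop :=
  θ.IsCycle ∧ θ.support = Finset.univ ∧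
  (∀ i : Fin (4 * n + 2), ((i : ℕ) < 2 * n + 1 ↔ 2 * n + 1 ≤ (θ i : ℕ))) ∧
  (∀ i : Fin (4 * n + 2), ((i : ℕ) < 2 * n + 1 ↔ ((θ ^ 2) i : ℕ) < 2 * n + 1)) ∧
  ((∀ i : Fin (4 * n + 2), (i : ℕ) < 2 * n + 1 → ((θ ^ 2) i : ℕ) = stefanAlphaFun n i) ∨
   (∀ i : Fin (4 * n + 2), (i : ℕ) < 2 * n + 1 → ((θ ^ 2) i : ℕ) = stefanBetaFun n i)) ∧
  ((∀ i : Fin (4 * n + 2), 2 * n + 1 ≤ (i : ℕ) →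
      ((θ ^ 2) i : ℕ) = stefanAlphaFun n ((i : ℕ) - (2 * n + 1)) + (2 * n + 1)) ∨
   (∀ i : Fin (4 * n + 2), 2 * n + 1 ≤ (i : ℕ) →
      ((θ ^ 2) i : ℕ) = stefanBetaFun n ((i : ℕ) - (2 * n + 1)) + (2 * n + 1)))

open Equiv (Perm)
open Equiv.Perm

section SwapPerm

variable {X : Type*}

/-- The permutation of `X ⊕ X` that interchanges the two summands, acting by `f` from the left
one to the right one and by `g` from the right one to the left one. -/
def swapPerm (f g : Perm X) : Perm (X ⊕ X) :=
  (Equiv.sumCongr f g).trans (Equiv.sumComm X X)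

@[simp] lemma swapPerm_inl (f g : Perm X) (x : X) : swapPerm f g (Sum.inl x) = Sum.inr (f x) := rfl

@[simp] lemma swapPerm_inr (f g : Perm X) (x : X) : swapPerm f g (Sum.inr x) = Sum.inl (g x) := rfl

lemma swapPerm_injective : Function.Injective fun p : Perm X × Perm X ↦ swapPerm p.1 p.2 := by
  rintro ⟨f, g⟩ ⟨f', g'⟩ h
  refine Prod.ext (Equiv.ext fun x ↦ ?_) (Equiv.ext fun x ↦ ?_)
  · simpa using Equiv.congr_fun h (Sum.inl x)
  · simpa using Equiv.congr_fun h (Sum.inr x)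

lemma exists_eq_swapPerm [Finite X] (σ : Perm (X ⊕ X)) (hl : ∀ x, ∃ y, σ (Sum.inl x) = Sum.inr y)
    (hr : ∀ x, ∃ y, σ (Sum.inr x) = Sum.inl y) : ∃ f g, σ = swapPerm f g := by
  choose f hf using hl
  choose g hg using hr
  have hfi : Function.Injective f := fun x y h ↦
    Sum.inl_injective (σ.injective (by rw [hf, hf, h]))
  have hgi : Function.Injective g := fun x y h ↦
    Sum.inr_injective (σ.injective (by rw [hg, hg, h]))
  refine ⟨Equiv.ofBijective f (Finite.injective_iff_bijective.1 hfi),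
    Equiv.ofBijective g (Finite.injective_iff_bijective.1 hgi), Equiv.ext ?_⟩
  rintro (x | x)
  · simp [hf]
  · simp [hg]

lemma sameCycle_swapPerm {f g : Perm X} (h : ∀ x y, (g * f).SameCycle x y) (a b : X ⊕ X) :
    (swapPerm f g).SameCycle a b := by
  have hpow : ∀ (k : ℕ) x, ((swapPerm f g) ^ (2 * k)) (Sum.inl x) = Sum.inl (((g * f) ^ k) x) := by
    intro k
    induction k with
    | zero => simp
    | succ k ih =>
      intro x
      rw [mul_add, mul_one, pow_add, pow_succ (g * f), Perm.mul_apply, Perm.mul_apply, ← ih]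
      simp [pow_two]
  have hzpow : ∀ (k : ℤ) x, ((swapPerm f g) ^ (2 * k)) (Sum.inl x) = Sum.inl (((g * f) ^ k) x) := by
    intro k x
    obtain ⟨k, rfl | rfl⟩ := k.eq_nat_or_neg
    · exact_mod_cast hpow k x
    · rw [mul_neg, zpow_neg, zpow_neg, Perm.inv_eq_iff_eq]
      have := hpow k (((g * f) ^ (-(k : ℤ))) x)
      rw [← Perm.mul_apply, zpow_neg, zpow_natCast, mul_inv_cancel, Perm.one_apply] at this
      rw [zpow_natCast, ← this]
      norm_cast
  have hinl : ∀ x y, (swapPerm f g).SameCycle (Sum.inl x) (Sum.inl y) := by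
    intro x y
    obtain ⟨k, hk⟩ := h x y
    exact ⟨2 * k, by rw [hzpow, hk]⟩
  have hto : ∀ a : X ⊕ X, ∃ x, (swapPerm f g).SameCycle a (Sum.inl x) := by
    rintro (x | x)
    · exact ⟨x, SameCycle.refl _ _⟩
    · exact ⟨g x, 1, by simp⟩
  obtain ⟨x, hx⟩ := hto a
  obtain ⟨y, hy⟩ := hto b
  exact hx.trans ((hinl x y).trans hy.symm)

/-- If `s` is a set of transitive cyclic permutations of a finite type `X`, there are
`|s|² |X|` pairs `(f, g)` with both `g * f` and `f * g` in `s`. -/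
lemma card_pairs_mul_mem [Fintype X] [Nonempty X] {s : Set (Perm X)}
    (hs : ∀ σ ∈ s, σ.IsCycleOn Set.univ) :
    Nat.card {p : Perm X × Perm X // p.2 * p.1 ∈ s ∧ p.1 * p.2 ∈ s} =
      Nat.card s ^ 2 * Nat.card X := by
  classical
  obtain ⟨x₀⟩ := ‹Nonempty X›
  let Φ : {p : Perm X × Perm X // p.2 * p.1 ∈ s ∧ p.1 * p.2 ∈ s} → (s × s) × X :=
    fun p ↦ ((⟨_, p.2.1⟩, ⟨_, p.2.2⟩), p.1.1 x₀)
  have hΦ : Function.Bijective Φ := by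
    constructor
    · rintro ⟨⟨f, g⟩, h₁, h₂⟩ ⟨⟨f', g'⟩, h₁', h₂'⟩ h
      simp only [Φ, Prod.mk.injEq, Subtype.mk.injEq] at h
      obtain ⟨⟨hγ, hδ⟩, hx⟩ := h
      have key : f = f' := by
        ext y
        obtain ⟨k, rfl⟩ := (hs _ h₁).2 (Set.mem_univ x₀) (Set.mem_univ y)
        have e₁ : f * (g * f) ^ k = (f * g) ^ k * f :=
          (SemiconjBy.zpow_right (show SemiconjBy f (g * f) (f * g) from (mul_assoc _ _ _).symm) k)
        have e₂ : f' * (g' * f') ^ k = (f' * g') ^ k * f' :=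
          (SemiconjBy.zpow_right
            (show SemiconjBy f' (g' * f') (f' * g') from (mul_assoc _ _ _).symm) k)
        change (f * (g * f) ^ k) x₀ = f' (((g * f) ^ k) x₀)
        rw [e₁, hγ, ← Perm.mul_apply, e₂, hδ, Perm.mul_apply, Perm.mul_apply, hx]
      subst key
      simpa using hγ
    · rintro ⟨⟨⟨γ, hγ⟩, ⟨δ, hδ⟩⟩, y⟩
      have hconj : ∃ f : Perm X, f * γ * f⁻¹ = δ := by
        by_cases hX : Nontrivial X
        · have hγ' := (isCycle_iff_exists_isCycleOn (f := γ)).2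
            ⟨Set.univ, Set.nontrivial_univ, hs γ hγ, fun _ _ ↦ trivial⟩
          have hδ' := (isCycle_iff_exists_isCycleOn (f := δ)).2
            ⟨Set.univ, Set.nontrivial_univ, hs δ hδ, fun _ _ ↦ trivial⟩
          refine isConj_iff.1 ((hγ'.isConj_iff hδ').2 ?_)
          have hsupp : ∀ σ ∈ s, σ.support = Finset.univ := fun σ hσ ↦
            Finset.eq_univ_of_forall fun x ↦
              mem_support.2 ((hs σ hσ).apply_ne Set.nontrivial_univ (Set.mem_univ x))
          rw [hsupp γ hγ, hsupp δ hδ]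
        · rw [not_nontrivial_iff_subsingleton] at hX
          exact ⟨1, Subsingleton.elim _ _⟩
      obtain ⟨f₀, hf₀⟩ := hconj
      obtain ⟨k, hk⟩ := (hs δ hδ).2 (Set.mem_univ (f₀ x₀)) (Set.mem_univ y)
      have hfg : (δ ^ k * f₀) * (γ * (δ ^ k * f₀)⁻¹) = δ := by
        rw [mul_inv_rev, ← mul_assoc, mul_assoc (δ ^ k), ← mul_assoc, mul_assoc (δ ^ k), hf₀,
          (Commute.zpow_self δ k).eq, mul_inv_cancel_right]
      have hgf : (γ * (δ ^ k * f₀)⁻¹) * (δ ^ k * f₀) = γ := inv_mul_cancel_right _ _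
      refine ⟨⟨(δ ^ k * f₀, γ * (δ ^ k * f₀)⁻¹), hgf.symm ▸ hγ, hfg.symm ▸ hδ⟩, ?_⟩
      simp only [Φ, Prod.mk.injEq, Subtype.mk.injEq]
      exact ⟨⟨hgf, hfg⟩, hk⟩
  rw [Nat.card_congr (Equiv.ofBijective Φ hΦ), Nat.card_prod, Nat.card_prod, pow_two]

end SwapPerm

section Stefan

/-- The Stefan permutation `α_{2n+1}` of `Fin (2 * n + 1)`. -/
noncomputable def stefanAlpha (n : ℕ) : Perm (Fin (2 * n + 1)) :=
  Equiv.ofBijective (fun i ↦ ⟨stefanAlphaFun n i, by unfold stefanAlphaFun; split_ifs <;> omega⟩)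
    (Finite.injective_iff_bijective.1 fun i j h ↦ by
      simp only [stefanAlphaFun, Fin.mk.injEq] at h
      ext
      split_ifs at h <;> omega)

/-- The Stefan permutation `β_{2n+1}` of `Fin (2 * n + 1)`. -/
noncomputable def stefanBeta (n : ℕ) : Perm (Fin (2 * n + 1)) :=
  Equiv.ofBijective (fun i ↦ ⟨stefanBetaFun n i, by unfold stefanBetaFun; split_ifs <;> omega⟩)
    (Finite.injective_iff_bijective.1 fun i j h ↦ by
      simp only [stefanBetaFun, Fin.mk.injEq] at h
      ext
      split_ifs at h <;> omega)

@[simp] lemma stefanAlpha_val (n : ℕ) (i : Fin (2 * n + 1)) :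
    (stefanAlpha n i : ℕ) = stefanAlphaFun n i := rfl

@[simp] lemma stefanBeta_val (n : ℕ) (i : Fin (2 * n + 1)) :
    (stefanBeta n i : ℕ) = stefanBetaFun n i := rfl

lemma stefanAlpha_ne_stefanBeta {n : ℕ} (hn : 1 ≤ n) : stefanAlpha n ≠ stefanBeta n := by
  intro h
  have h₀ : stefanAlphaFun n 0 = stefanBetaFun n 0 :=
    congrArg Fin.val (Equiv.congr_fun h 0)
  simp only [stefanAlphaFun, stefanBetaFun, if_pos (show 0 < n from hn), if_true] at h₀
  omega

lemma isCycleOn_univ_of_sameCycle {X : Type*} {σ : Perm X} (x₀ : X)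
    (h : ∀ x, σ.SameCycle x₀ x) : σ.IsCycleOn Set.univ :=
  ⟨Set.bijOn_univ.2 σ.bijective, fun _ _ _ _ ↦ (h _).symm.trans (h _)⟩

lemma isCycleOn_stefanAlpha (n : ℕ) : (stefanAlpha n).IsCycleOn Set.univ := by
  have hstep : ∀ k (hk : k ≤ n), (stefanAlpha n).SameCycle ⟨n, by omega⟩ ⟨n + k, by omega⟩ ∧
      (k < n → (stefanAlpha n).SameCycle ⟨n, by omega⟩ ⟨n - 1 - k, by omega⟩) := by
    intro k
    induction k with
    | zero =>
      refine fun _ ↦ ⟨SameCycle.refl _ _, fun _ ↦ ⟨1, ?_⟩⟩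
      ext
      simp only [zpow_one, stefanAlpha_val, stefanAlphaFun]
      split_ifs <;> omega
    | succ k ih =>
      intro hk
      have h₁ : (stefanAlpha n).SameCycle ⟨n, by omega⟩ ⟨n + (k + 1), by omega⟩ := by
        refine ((ih (by omega)).2 hk).trans ⟨1, ?_⟩
        ext
        simp only [zpow_one, stefanAlpha_val, stefanAlphaFun]
        split_ifs <;> omega
      refine ⟨h₁, fun hk' ↦ h₁.trans ⟨1, ?_⟩⟩
      ext
      simp only [zpow_one, stefanAlpha_val, stefanAlphaFun]
      split_ifs <;> omega
  refine isCycleOn_univ_of_sameCycle (⟨n, by omega⟩ : Fin (2 * n + 1)) fun x ↦ ?_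
  by_cases hx : n ≤ (x : ℕ)
  · convert (hstep (x - n) (by omega)).1 using 1
    ext
    simp only
    omega
  · convert (hstep (n - 1 - x) (by omega)).2 (by omega) using 1
    ext
    simp only
    omega

lemma isCycleOn_stefanBeta (n : ℕ) : (stefanBeta n).IsCycleOn Set.univ := by
  have hstep : ∀ k (hk : k ≤ n), (stefanBeta n).SameCycle ⟨n, by omega⟩ ⟨n - k, by omega⟩ ∧
      ∀ hk' : k < n, (stefanBeta n).SameCycle ⟨n, by omega⟩ ⟨n + 1 + k, by omega⟩ := by
    intro k
    induction k with
    | zero =>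
      refine fun _ ↦ ⟨SameCycle.refl _ _, fun _ ↦ ⟨1, ?_⟩⟩
      ext
      simp only [zpow_one, stefanBeta_val, stefanBetaFun]
      split_ifs <;> omega
    | succ k ih =>
      intro hk
      have h₁ : (stefanBeta n).SameCycle ⟨n, by omega⟩ ⟨n - (k + 1), by omega⟩ := by
        refine ((ih (by omega)).2 hk).trans ⟨1, ?_⟩
        ext
        simp only [zpow_one, stefanBeta_val, stefanBetaFun]
        split_ifs <;> omega
      refine ⟨h₁, fun hk' ↦ h₁.trans ⟨1, ?_⟩⟩
      ext
      simp only [zpow_one, stefanBeta_val, stefanBetaFun]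
      split_ifs <;> omega
  refine isCycleOn_univ_of_sameCycle (⟨n, by omega⟩ : Fin (2 * n + 1)) fun x ↦ ?_
  by_cases hx : (x : ℕ) ≤ n
  · convert (hstep (n - x) (by omega)).1 using 1
    ext
    simp only
    omega
  · convert (hstep (x - (n + 1)) (by omega)).2 (by omega) using 1
    ext
    simp only
    omega

end Stefan

section Blocks

/-- The identification of two copies of `Fin (2 * n + 1)` with the two blocks of
`Fin (4 * n + 2)`. -/
def blockEquiv (n : ℕ) : Fin (2 * n + 1) ⊕ Fin (2 * n + 1) ≃ Fin (4 * n + 2) :=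
  finSumFinEquiv.trans (finCongr (by omega))

@[simp] lemma blockEquiv_inl_val (n : ℕ) (i : Fin (2 * n + 1)) :
    (blockEquiv n (Sum.inl i) : ℕ) = i := rfl

@[simp] lemma blockEquiv_inr_val (n : ℕ) (i : Fin (2 * n + 1)) :
    (blockEquiv n (Sum.inr i) : ℕ) = i + (2 * n + 1) := by
  simp [blockEquiv, add_comm]

lemma forall_block {n : ℕ} {P : Fin (4 * n + 2) → Prop} :
    (∀ i, P i) ↔ (∀ i, P (blockEquiv n (Sum.inl i))) ∧ ∀ i, P (blockEquiv n (Sum.inr i)) := by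
  rw [← (blockEquiv n).forall_congr_right, Sum.forall]

lemma exists_permCongr_swapPerm {n : ℕ} {θ : Perm (Fin (4 * n + 2))}
    (h : ∀ i : Fin (4 * n + 2), (i : ℕ) < 2 * n + 1 ↔ 2 * n + 1 ≤ (θ i : ℕ)) :
    ∃ f g, θ = (blockEquiv n).permCongr (swapPerm f g) := by
  rw [forall_block] at h
  obtain ⟨f, g, hfg⟩ := exists_eq_swapPerm ((blockEquiv n).symm.permCongr θ)
    (fun x ↦ by
      have hx := (h.1 x).1 (by rw [blockEquiv_inl_val]; omega)
      obtain ⟨y | y, hy⟩ := (blockEquiv n).surjective (θ (blockEquiv n (Sum.inl x)))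
      · rw [← hy, blockEquiv_inl_val] at hx
        omega
      · exact ⟨y, by simp [Equiv.permCongr_apply, ← hy]⟩)
    (fun x ↦ by
      have hx := (h.2 x).not.1 (by rw [blockEquiv_inr_val]; omega)
      obtain ⟨y | y, hy⟩ := (blockEquiv n).surjective (θ (blockEquiv n (Sum.inr x)))
      · exact ⟨y, by simp [Equiv.permCongr_apply, ← hy]⟩
      · rw [← hy, blockEquiv_inr_val] at hx
        omega)
  refine ⟨f, g, ?_⟩
  rw [← hfg]
  ext
  simp [Equiv.permCongr_apply]

lemma isSim_permCongr_swapPerm {n : ℕ} (f g : Perm (Fin (2 * n + 1))) :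
    IsSim n ((blockEquiv n).permCongr (swapPerm f g)) ↔
      g * f ∈ ({stefanAlpha n, stefanBeta n} : Set _) ∧
      f * g ∈ ({stefanAlpha n, stefanBeta n} : Set _) := by
  set θ := (blockEquiv n).permCongr (swapPerm f g) with hθ
  have hl : ∀ x, θ (blockEquiv n (Sum.inl x)) = blockEquiv n (Sum.inr (f x)) := by
    simp [hθ, Equiv.permCongr_apply]
  have hr : ∀ x, θ (blockEquiv n (Sum.inr x)) = blockEquiv n (Sum.inl (g x)) := by
    simp [hθ, Equiv.permCongr_apply]
  have hext : ∀ (σ τ : Perm (Fin (2 * n + 1))), σ = τ ↔ ∀ i, (σ i : ℕ) = τ i := fun σ τ ↦ by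
    simp [Equiv.ext_iff, Fin.ext_iff]
  have hle (i : Fin (2 * n + 1)) : (i : ℕ) ≤ 2 * n := by omega
  have hnlt (i : Fin (2 * n + 1)) : ¬ 2 * n < (i : ℕ) := by omega
  have hgt (i : Fin (2 * n + 1)) : 2 * n < (i : ℕ) + (2 * n + 1) := by omega
  have hnge (i : Fin (2 * n + 1)) : ¬ (i : ℕ) + (2 * n + 1) ≤ 2 * n := by omega
  have hblocks : ∀ i : Fin (4 * n + 2), (i : ℕ) < 2 * n + 1 ↔ 2 * n + 1 ≤ (θ i : ℕ) := by
    rw [forall_block]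
    refine ⟨fun i ↦ ?_, fun i ↦ ?_⟩
    · rw [hl, blockEquiv_inl_val, blockEquiv_inr_val]
      omega
    · rw [hr, blockEquiv_inl_val, blockEquiv_inr_val]
      omega
  unfold IsSim
  have hsq : ((∀ i : Fin (4 * n + 2), (i : ℕ) < 2 * n + 1 →
        ((θ ^ 2) i : ℕ) = stefanAlphaFun n i) ∨
      (∀ i : Fin (4 * n + 2), (i : ℕ) < 2 * n + 1 → ((θ ^ 2) i : ℕ) = stefanBetaFun n i)) ↔
      g * f ∈ ({stefanAlpha n, stefanBeta n} : Set _) := by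
    simp [forall_block, pow_two, hl, hr, hext, hle, hnge]
  have hsq' : ((∀ i : Fin (4 * n + 2), 2 * n + 1 ≤ (i : ℕ) →
        ((θ ^ 2) i : ℕ) = stefanAlphaFun n ((i : ℕ) - (2 * n + 1)) + (2 * n + 1)) ∨
      (∀ i : Fin (4 * n + 2), 2 * n + 1 ≤ (i : ℕ) →
        ((θ ^ 2) i : ℕ) = stefanBetaFun n ((i : ℕ) - (2 * n + 1)) + (2 * n + 1))) ↔
      f * g ∈ ({stefanAlpha n, stefanBeta n} : Set _) := by
    simp [forall_block, pow_two, hl, hr, hext, hnlt, hgt]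
  rw [hsq, hsq']
  refine ⟨fun h ↦ h.2.2.2.2, fun h ↦ ?_⟩
  have hne : ∀ i, θ i ≠ i := fun i hi ↦ by
    have := hblocks i
    rw [hi] at this
    omega
  have hcyc : (g * f).IsCycleOn Set.univ := by
    rcases h.1 with h₁ | h₁
    · exact h₁ ▸ isCycleOn_stefanAlpha n
    · exact h₁ ▸ isCycleOn_stefanBeta n
  have hsame : ∀ i j, θ.SameCycle i j := by
    intro i j
    obtain ⟨a, rfl⟩ := (blockEquiv n).surjective i
    obtain ⟨b, rfl⟩ := (blockEquiv n).surjective j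
    obtain ⟨k, rfl⟩ := sameCycle_swapPerm
      (fun x y ↦ hcyc.2 (Set.mem_univ x) (Set.mem_univ y)) a b
    refine ⟨k, ?_⟩
    rw [hθ, ← Equiv.permCongrHom_coe, ← map_zpow]
    simp [Equiv.permCongr_apply]
  refine ⟨⟨0, hne 0, fun j _ ↦ hsame 0 j⟩, ?_, hblocks, ?_, h⟩
  · exact Finset.eq_univ_of_forall fun i ↦ mem_support.2 (hne i)
  · rw [forall_block]
    refine ⟨fun i ↦ ?_, fun i ↦ ?_⟩
    · simp [pow_two, hl, hr, hle]
    · simp [pow_two, hl, hr, hnge]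

end Blocks

/-- The number of simple permutations of order `4n+2` is exactly `8n+4`. -/
theorem card_sim (n : ℕ) (hn : 1 ≤ n) :
    Nat.card {θ : Equiv.Perm (Fin (4 * n + 2)) // IsSim n θ} = 8 * n + 4 := by
  let s : Set (Perm (Fin (2 * n + 1))) := {stefanAlpha n, stefanBeta n}
  let Ψ : {p : Perm (Fin (2 * n + 1)) × Perm (Fin (2 * n + 1)) //
      p.2 * p.1 ∈ s ∧ p.1 * p.2 ∈ s} → {θ : Perm (Fin (4 * n + 2)) // IsSim n θ} :=
    fun p ↦ ⟨(blockEquiv n).permCongr (swapPerm p.1.1 p.1.2),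
      (isSim_permCongr_swapPerm _ _).2 p.2⟩
  have hΨ : Function.Bijective Ψ := by
    constructor
    · intro p q h
      exact Subtype.ext (swapPerm_injective
        ((blockEquiv n).permCongr.injective (congrArg Subtype.val h)))
    · rintro ⟨θ, hθ⟩
      obtain ⟨f, g, rfl⟩ := exists_permCongr_swapPerm hθ.2.2.1
      exact ⟨⟨(f, g), (isSim_permCongr_swapPerm f g).1 hθ⟩, rfl⟩
  have hs : ∀ σ ∈ s, σ.IsCycleOn Set.univ := by
    rintro σ (rfl | rfl)
    · exact isCycleOn_stefanAlpha n
    · exact isCycleOn_stefanBeta n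
  have hcard : Nat.card s = 2 := by
    rw [Nat.card_coe_set_eq, Set.ncard_pair (stefanAlpha_ne_stefanBeta hn)]
  rw [← Nat.card_congr (Equiv.ofBijective Ψ hΨ), card_pairs_mul_mem hs, hcard, Nat.card_fin]
  ring
end

section
/- For every n ≥ 1, let θ_{4n+2} := α_{2n+1} |⋄ e_{2n+1} ∈ S_{4n+2}. Then θ_{4n+2}² = α_{2n+1} ⋄| α_{2n+1}. -/
theorem lpaste_castAdd {m n : ℕ} (α : Equiv.Perm (Fin m)) (β : Equiv.Perm (Fin n)) (i : Fin m) :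
    lpaste α β (Fin.castAdd n i) = Fin.cast (Nat.add_comm n m) (Fin.natAdd n (α i)) := by
  simp [lpaste]

theorem lpaste_natAdd {m n : ℕ} (α : Equiv.Perm (Fin m)) (β : Equiv.Perm (Fin n)) (j : Fin n) :
    lpaste α β (Fin.natAdd m j) = Fin.cast (Nat.add_comm n m) (Fin.castAdd m (β j)) := by
  simp [lpaste]

theorem rpaste_castAdd {m n : ℕ} (α : Equiv.Perm (Fin m)) (β : Equiv.Perm (Fin n)) (i : Fin m) :
    rpaste α β (Fin.castAdd n i) = Fin.castAdd n (α i) := by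
  simp [rpaste, Equiv.permCongr_apply]

theorem rpaste_natAdd {m n : ℕ} (α : Equiv.Perm (Fin m)) (β : Equiv.Perm (Fin n)) (j : Fin n) :
    rpaste α β (Fin.natAdd m j) = Fin.natAdd m (β j) := by
  simp [rpaste, Equiv.permCongr_apply]

/-- Squaring the left pasting of two permutations of the same degree gives the right pasting of
their two products. -/
theorem lpaste_sq {m : ℕ} (α β : Equiv.Perm (Fin m)) :
    lpaste α β ^ 2 = rpaste (β * α) (α * β) := by
  refine Equiv.ext fun x => ?_
  rw [pow_two, Equiv.Perm.mul_apply]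
  induction x using Fin.addCases <;>
    simp only [lpaste_castAdd, lpaste_natAdd, rpaste_castAdd, rpaste_natAdd, Fin.cast_eq_self,
      Equiv.Perm.mul_apply]

/-- For `θ_{4n+2} := α_{2n+1} |⋄ e_{2n+1}` one has `θ_{4n+2}² = α_{2n+1} ⋄| α_{2n+1}`. -/
theorem theta_sq (n : ℕ) (hn : 1 ≤ n) (α : Equiv.Perm (Fin (2 * n + 1)))
    (hα : ∀ i : Fin (2 * n + 1), (α i : ℕ) = stefanAlphaFun n i) :
    (lpaste α (1 : Equiv.Perm (Fin (2 * n + 1)))) ^ 2 = rpaste α α := by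
  rw [lpaste_sq, one_mul, mul_one]
end

section
/- For every n ≥ 1, let φ_{4n+2} := β_{2n+1} |⋄ e_{2n+1} ∈ S_{4n+2}. Then φ_{4n+2}² = β_{2n+1} ⋄| β_{2n+1}. -/
/-- For `φ_{4n+2} := β_{2n+1} |⋄ e_{2n+1}` one has `φ_{4n+2}² = β_{2n+1} ⋄| β_{2n+1}`. -/
theorem phi_sq (n : ℕ) (hn : 1 ≤ n) (β : Equiv.Perm (Fin (2 * n + 1)))
    (hβ : ∀ i : Fin (2 * n + 1), (β i : ℕ) = stefanBetaFun n i) :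
    (lpaste β (1 : Equiv.Perm (Fin (2 * n + 1)))) ^ 2 = rpaste β β := by
  rw [lpaste_sq, one_mul, mul_one]
end

section
/- For every n ≥ 1, the permutation θ_{4n+2} := α_{2n+1} |⋄ e_{2n+1} ∈ S_{4n+2} is a simple permutation of order 4n+2, i.e., θ_{4n+2} ∈ Sim(4n+2); in particular θ_{4n+2} is a (4n+2)-cycle. -/
theorem lpaste_val_of_lt {m n : ℕ} (α : Equiv.Perm (Fin m)) (β : Equiv.Perm (Fin n))
    (i : Fin (m + n)) (hi : (i : ℕ) < m) :
    (lpaste α β i : ℕ) = (α ⟨i, hi⟩ : ℕ) + n := by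
  obtain ⟨j, rfl⟩ : ∃ j : Fin m, i = Fin.castAdd n j := ⟨⟨i, hi⟩, rfl⟩
  simp [lpaste, add_comm]

theorem lpaste_val_of_le {m n : ℕ} (α : Equiv.Perm (Fin m)) (β : Equiv.Perm (Fin n))
    (i : Fin (m + n)) (hi : m ≤ (i : ℕ)) :
    (lpaste α β i : ℕ) = (β ⟨i - m, by omega⟩ : ℕ) := by
  obtain ⟨j, rfl⟩ : ∃ j : Fin n, i = Fin.natAdd m j :=
    ⟨⟨i - m, by omega⟩, Fin.ext (by simp; omega)⟩
  simp [lpaste]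

/-- If `θ` swaps the two blocks, acting by `stefanAlphaFun` on the first and by translation on the
second, then the middle point of the first block reaches every point. -/
theorem sameCycle_middle_of_swap_blocks {n : ℕ} {θ : Equiv.Perm (Fin (4 * n + 2))}
    (hlt : ∀ i : Fin (4 * n + 2), (i : ℕ) < 2 * n + 1 →
      (θ i : ℕ) = stefanAlphaFun n i + (2 * n + 1))
    (hle : ∀ i : Fin (4 * n + 2), 2 * n + 1 ≤ (i : ℕ) → (θ i : ℕ) = i - (2 * n + 1))
    (i : Fin (4 * n + 2)) : θ.SameCycle ⟨n, by omega⟩ i := by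
  set c : Fin (4 * n + 2) := ⟨n, by omega⟩ with hc
  have step (x y : Fin (4 * n + 2)) (hx : (x : ℕ) < 2 * n + 1)
      (hxy : (y : ℕ) = stefanAlphaFun n x) (h : θ.SameCycle c x) : θ.SameCycle c y := by
    have hy : θ (θ x) = y := by
      have := hlt x hx
      have := hle (θ x) (by omega)
      exact Fin.ext (by omega)
    rw [← hy, Equiv.Perm.sameCycle_apply_right, Equiv.Perm.sameCycle_apply_right]
    exact h
  have down (k : ℕ) (hk : k < n) (h : θ.SameCycle c ⟨n + k, by omega⟩) :
      θ.SameCycle c ⟨n - 1 - k, by omega⟩ :=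
    step ⟨n + k, by omega⟩ _ (by simp; omega) (by grind [stefanAlphaFun]) h
  have upper (k : ℕ) (hk : k ≤ n) : θ.SameCycle c ⟨n + k, by omega⟩ := by
    induction k with
    | zero => exact .refl _ _
    | succ k ih =>
      exact step ⟨n - 1 - k, by omega⟩ _ (by simp; omega) (by grind [stefanAlphaFun])
        (down k (by omega) (ih (by omega)))
  have first (j : Fin (4 * n + 2)) (hj : (j : ℕ) < 2 * n + 1) : θ.SameCycle c j := by
    rcases le_or_gt n j with h | h
    · convert upper (j - n) (by omega) using 1
      exact Fin.ext (by simp; omega)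
    · convert down (n - 1 - j) (by omega) (upper _ (by omega)) using 1
      exact Fin.ext (by simp; omega)
  rcases lt_or_ge (i : ℕ) (2 * n + 1) with h | h
  · exact first i h
  · rw [← Equiv.Perm.sameCycle_apply_right]
    exact first _ (by rw [hle i h]; omega)

theorem isSim_of_swap_blocks {n : ℕ} {θ : Equiv.Perm (Fin (4 * n + 2))}
    (hlt : ∀ i : Fin (4 * n + 2), (i : ℕ) < 2 * n + 1 →
      (θ i : ℕ) = stefanAlphaFun n i + (2 * n + 1))
    (hle : ∀ i : Fin (4 * n + 2), 2 * n + 1 ≤ (i : ℕ) → (θ i : ℕ) = i - (2 * n + 1)) : IsSim n θ := by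
  have swap (i : Fin (4 * n + 2)) : (i : ℕ) < 2 * n + 1 ↔ 2 * n + 1 ≤ (θ i : ℕ) := by
    have := hlt i
    have := hle i
    omega
  have hne (i : Fin (4 * n + 2)) : θ i ≠ i := fun h => by
    have := swap i
    rw [h] at this
    omega
  have sq (i : Fin (4 * n + 2)) : (θ ^ 2) i = θ (θ i) := by rw [pow_two, Equiv.Perm.mul_apply]
  refine ⟨⟨⟨n, by omega⟩, hne _, fun i _ => sameCycle_middle_of_swap_blocks hlt hle i⟩, ?_, swap,
    fun i => ?_, .inl fun i hi => ?_, .inl fun i hi => ?_⟩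
  · ext i
    simp [hne i]
  · rw [sq]
    have := swap i
    have := swap (θ i)
    omega
  · rw [sq, hle _ ((swap i).1 hi), hlt i hi]
    omega
  · have hval := hle i hi
    rw [sq, hlt _ (by omega), hval]

/-- The permutation `θ_{4n+2} := α_{2n+1} |⋄ e_{2n+1}` belongs to `Sim(4n+2)`; in particular it is a
`(4n+2)`-cycle. -/
theorem theta_isSim (n : ℕ) (hn : 1 ≤ n) (α : Equiv.Perm (Fin (2 * n + 1)))
    (h : ∀ i : Fin (2 * n + 1), (α i : ℕ) = stefanAlphaFun n i) :
    IsSim n ((finCongr (show (2 * n + 1) + (2 * n + 1) = 4 * n + 2 by ring)).permCongr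
      (lpaste α (1 : Equiv.Perm (Fin (2 * n + 1))))) := by
  refine isSim_of_swap_blocks (fun i hi => ?_) (fun i hi => ?_)
  · simp only [Equiv.permCongr_apply, finCongr_apply, finCongr_symm, Fin.val_cast]
    rw [lpaste_val_of_lt _ _ _ (by simpa using hi), h]
    simp
  · simp only [Equiv.permCongr_apply, finCongr_apply, finCongr_symm, Fin.val_cast]
    rw [lpaste_val_of_le _ _ _ (by simpa using hi)]
    simp
end

section
/- For every n ≥ 1, the permutation η_{4n+2} := e_{2n+1} |⋄ α_{2n+1} ∈ S_{4n+2} is a simple permutation of order 4n+2, i.e., η_{4n+2} ∈ Sim(4n+2); in particular η_{4n+2} is a (4n+2)-cycle. -/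
/-- The first block is shifted up by a left pasting with the identity. -/
theorem lpaste_one_val_of_lt {m n : ℕ} (α : Equiv.Perm (Fin n)) (i : Fin (m + n))
    (hi : (i : ℕ) < m) :
    (lpaste (1 : Equiv.Perm (Fin m)) α i : ℕ) = i + n := by
  obtain ⟨j, rfl⟩ : ∃ j : Fin m, i = Fin.castAdd n j := ⟨⟨i, hi⟩, rfl⟩
  simp [lpaste, Nat.add_comm]

/-- A left pasting acts on the second block by its second argument. -/
theorem lpaste_val_natAdd {m n : ℕ} (σ : Equiv.Perm (Fin m)) (α : Equiv.Perm (Fin n))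
    (j : Fin n) : (lpaste σ α (Fin.natAdd m j) : ℕ) = α j := by
  simp [lpaste]

theorem stefanAlphaFun_lt {n i : ℕ} : stefanAlphaFun n i < 2 * n + 1 := by
  unfold stefanAlphaFun
  split_ifs <;> omega

/-- A permutation that shifts the first block onto the second, and maps the second back onto the
first by the Stefan permutation, has a single orbit. -/
theorem sameCycle_of_shift_of_stefanAlphaFun {n : ℕ} {θ : Equiv.Perm (Fin (4 * n + 2))}
    (h₁ : ∀ i : Fin (4 * n + 2), (i : ℕ) < 2 * n + 1 → (θ i : ℕ) = i + (2 * n + 1))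
    (h₂ : ∀ i : Fin (4 * n + 2), 2 * n + 1 ≤ (i : ℕ) →
      (θ i : ℕ) = stefanAlphaFun n (i - (2 * n + 1)))
    (y : Fin (4 * n + 2)) : θ.SameCycle ⟨n, by omega⟩ y := by
  have sq : ∀ i : Fin (4 * n + 2), (i : ℕ) < 2 * n + 1 →
      (θ (θ i) : ℕ) = stefanAlphaFun n i := by
    intro i hi
    rw [h₂ _ (by rw [h₁ i hi]; omega), h₁ i hi, Nat.add_sub_cancel]
  have step : ∀ {x z w : Fin (4 * n + 2)}, (z : ℕ) < 2 * n + 1 →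
      stefanAlphaFun n z = w → θ.SameCycle x z → θ.SameCycle x w := by
    intro x z w hz hw hx
    have hzw : θ (θ z) = w := Fin.ext ((sq z hz).trans hw)
    rw [← hzw]
    exact hx.apply_right.apply_right
  have down : ∀ k (hk : k < n),
      θ.SameCycle ⟨n, by omega⟩ ⟨n + k, by omega⟩ →
      θ.SameCycle ⟨n, by omega⟩ ⟨n - 1 - k, by omega⟩ := by
    intro k hk
    refine step (by simp only; omega) ?_
    simp only [stefanAlphaFun]
    split_ifs <;> omega
  have up : ∀ k (hk : k ≤ n), θ.SameCycle ⟨n, by omega⟩ ⟨n + k, by omega⟩ := by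
    intro k
    induction k with
    | zero => intro _; exact Equiv.Perm.SameCycle.refl _ _
    | succ k ih =>
      intro hk
      refine step (by simp only; omega) ?_ (down k (by omega) (ih (by omega)))
      simp only [stefanAlphaFun]
      split_ifs <;> omega
  have first : ∀ z : Fin (4 * n + 2), (z : ℕ) < 2 * n + 1 →
      θ.SameCycle ⟨n, by omega⟩ z := by
    intro z hz
    rcases le_or_gt n (z : ℕ) with hnz | hnz
    · convert up (z - n) (by omega) using 1
      exact Fin.ext (by simp only; omega)
    · convert down (n - 1 - z) (by omega) (up _ (by omega)) using 1
      exact Fin.ext (by simp only; omega)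
  rcases lt_or_ge (y : ℕ) (2 * n + 1) with hy | hy
  · exact first y hy
  · refine Equiv.Perm.sameCycle_apply_right.mp (first _ ?_)
    rw [h₂ y hy]
    exact stefanAlphaFun_lt

theorem isSim_of_shift_of_stefanAlphaFun {n : ℕ} {θ : Equiv.Perm (Fin (4 * n + 2))}
    (h₁ : ∀ i : Fin (4 * n + 2), (i : ℕ) < 2 * n + 1 → (θ i : ℕ) = i + (2 * n + 1))
    (h₂ : ∀ i : Fin (4 * n + 2), 2 * n + 1 ≤ (i : ℕ) →
      (θ i : ℕ) = stefanAlphaFun n (i - (2 * n + 1))) :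
    IsSim n θ := by
  have swap : ∀ i : Fin (4 * n + 2), (i : ℕ) < 2 * n + 1 ↔ 2 * n + 1 ≤ (θ i : ℕ) := by
    intro i
    rcases lt_or_ge (i : ℕ) (2 * n + 1) with hi | hi
    · have := h₁ i hi
      omega
    · have := h₂ i hi
      have := stefanAlphaFun_lt (n := n) (i := i - (2 * n + 1))
      omega
  have ne : ∀ i, θ i ≠ i := by
    intro i hi
    have := swap i
    rw [hi] at this
    omega
  have sq : ∀ i, (θ ^ 2) i = θ (θ i) := fun i => by rw [pow_two, Equiv.Perm.mul_apply]
  refine ⟨⟨_, ne _, fun y _ => sameCycle_of_shift_of_stefanAlphaFun h₁ h₂ y⟩, ?_, swap, ?_,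
    Or.inl ?_, Or.inl ?_⟩
  · ext i
    simp [ne i]
  · intro i
    rw [sq]
    have := swap i
    have := swap (θ i)
    omega
  · intro i hi
    rw [sq, h₂ _ ((swap i).mp hi), h₁ i hi, Nat.add_sub_cancel]
  · intro i hi
    have := swap i
    rw [sq, h₁ _ (by omega), h₂ i hi]

/-- The permutation `η_{4n+2} := e_{2n+1} |⋄ α_{2n+1}` belongs to `Sim(4n+2)`; in particular it is a
`(4n+2)`-cycle. -/
theorem eta_isSim (n : ℕ) (hn : 1 ≤ n) (α : Equiv.Perm (Fin (2 * n + 1)))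
    (h : ∀ i : Fin (2 * n + 1), (α i : ℕ) = stefanAlphaFun n i) :
    IsSim n ((finCongr (show (2 * n + 1) + (2 * n + 1) = 4 * n + 2 by ring)).permCongr
      (lpaste (1 : Equiv.Perm (Fin (2 * n + 1))) α)) := by
  have e : (2 * n + 1) + (2 * n + 1) = 4 * n + 2 := by ring
  apply isSim_of_shift_of_stefanAlphaFun
  · intro i hi
    exact lpaste_one_val_of_lt α (Fin.cast e.symm i) hi
  · intro i hi
    have hj : (i : ℕ) - (2 * n + 1) < 2 * n + 1 := by omega
    have hi' : Fin.cast e.symm i = Fin.natAdd (2 * n + 1) ⟨i - (2 * n + 1), hj⟩ :=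
      Fin.ext (by simp only [Fin.val_cast, Fin.val_natAdd]; omega)
    have := lpaste_val_natAdd (1 : Equiv.Perm (Fin (2 * n + 1))) α ⟨i - (2 * n + 1), hj⟩
    rw [← hi', h] at this
    exact this
end

section
/- For every n ≥ 1, the permutation φ_{4n+2} := β_{2n+1} |⋄ e_{2n+1} ∈ S_{4n+2} is a simple permutation of order 4n+2, i.e., φ_{4n+2} ∈ Sim(4n+2); in particular φ_{4n+2} is a (4n+2)-cycle. -/
theorem lpaste_one_val {m n : ℕ} (α : Equiv.Perm (Fin m)) (i : Fin (m + n)) :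
    (lpaste α (1 : Equiv.Perm (Fin n)) i : ℕ) =
      if hi : (i : ℕ) < m then (α ⟨i, hi⟩ : ℕ) + n else (i : ℕ) - m := by
  refine Fin.addCases (fun j => ?_) (fun j => ?_) i
  · simp [lpaste, Nat.add_comm]
  · simp [lpaste]

/-- Every point of `{0,…,2n}` is reached from `0` by iterating `stefanBetaFun n`. -/
theorem stefanBetaFun_induction (n : ℕ) {P : ℕ → Prop} (zero : P 0)
    (step : ∀ i ≤ 2 * n, P i → P (stefanBetaFun n i)) {i : ℕ} (hi : i ≤ 2 * n) : P i := by
  have key : ∀ k < n, P (n - k) ∧ P (n + 1 + k) := by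
    intro k
    induction k with
    | zero =>
      intro hk
      have h1 : P n := by simpa [stefanBetaFun] using step 0 (by omega) zero
      have h2 := step n (by omega) h1
      rw [stefanBetaFun, if_neg (by omega), if_pos le_rfl,
        show 2 * n + 1 - n = n + 1 by omega] at h2
      exact ⟨h1, h2⟩
    | succ k ih =>
      intro hk
      have h1 := step _ (by omega) (ih (by omega)).2
      rw [stefanBetaFun, if_neg (by omega), if_neg (by omega),
        show 2 * n - (n + 1 + k) = n - (k + 1) by omega] at h1
      have h2 := step _ (by omega) h1
      rw [stefanBetaFun, if_neg (by omega), if_pos (by omega),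
        show 2 * n + 1 - (n - (k + 1)) = n + 1 + (k + 1) by omega] at h2
      exact ⟨h1, h2⟩
  rcases Nat.eq_zero_or_pos i with rfl | h0
  · exact zero
  rcases le_or_gt i n with hin | hin
  · simpa [Nat.sub_sub_self hin] using (key (n - i) (by omega)).1
  · simpa [show n + 1 + (i - (n + 1)) = i by omega] using (key (i - (n + 1)) (by omega)).2

theorem isSim_of_stefanBetaFun {n : ℕ} (θ : Equiv.Perm (Fin (4 * n + 2)))
    (hlow : ∀ i : Fin (4 * n + 2), (i : ℕ) < 2 * n + 1 →
      (θ i : ℕ) = stefanBetaFun n i + (2 * n + 1))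
    (hhigh : ∀ i : Fin (4 * n + 2), 2 * n + 1 ≤ (i : ℕ) → (θ i : ℕ) = i - (2 * n + 1)) :
    IsSim n θ := by
  have swap : ∀ i : Fin (4 * n + 2), (i : ℕ) < 2 * n + 1 ↔ 2 * n + 1 ≤ (θ i : ℕ) := by
    intro i
    constructor
    · intro hi
      rw [hlow i hi]
      omega
    · intro hi
      by_contra hc
      rw [hhigh i (by omega)] at hi
      omega
  have move : ∀ i, θ i ≠ i := by
    intro i hi
    have := swap i
    rw [hi] at this
    omega
  have sq_low : ∀ i : Fin (4 * n + 2), (i : ℕ) < 2 * n + 1 →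
      ((θ ^ 2) i : ℕ) = stefanBetaFun n i := by
    intro i hi
    rw [pow_two, Equiv.Perm.mul_apply, hhigh _ ((swap i).1 hi), hlow i hi, Nat.add_sub_cancel]
  have sq_high : ∀ i : Fin (4 * n + 2), 2 * n + 1 ≤ (i : ℕ) →
      ((θ ^ 2) i : ℕ) = stefanBetaFun n ((i : ℕ) - (2 * n + 1)) + (2 * n + 1) := by
    intro i hi
    rw [pow_two, Equiv.Perm.mul_apply, hlow (θ i) (by rw [hhigh i hi]; omega), hhigh i hi]
  have low_sameCycle : ∀ i : Fin (4 * n + 2), (i : ℕ) < 2 * n + 1 → θ.SameCycle 0 i := by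
    intro i hi
    refine stefanBetaFun_induction n
      (P := fun k => ∀ j : Fin (4 * n + 2), (j : ℕ) = k → θ.SameCycle 0 j)
      ?_ ?_ (Nat.lt_succ_iff.1 hi) i rfl
    · intro j hj
      rw [show j = 0 from Fin.ext hj]
    · intro k hk hP j hj
      have hj' : (θ ^ 2) ⟨k, by omega⟩ = j :=
        Fin.ext ((sq_low ⟨k, by omega⟩ (Nat.lt_succ_of_le hk)).trans hj.symm)
      rw [← hj', Equiv.Perm.sameCycle_pow_right]
      exact hP _ rfl
  have all_sameCycle : ∀ i, θ.SameCycle 0 i := by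
    intro i
    by_cases hi : (i : ℕ) < 2 * n + 1
    · exact low_sameCycle i hi
    · rw [← Equiv.Perm.sameCycle_apply_right]
      exact low_sameCycle _ (by rw [hhigh i (by omega)]; omega)
  refine ⟨⟨0, move 0, fun i _ => all_sameCycle i⟩, ?_, swap, ?_, Or.inr sq_low, Or.inr sq_high⟩
  · ext i
    simpa using move i
  · intro i
    have h1 := swap i
    have h2 := swap (θ i)
    rw [pow_two, Equiv.Perm.mul_apply]
    omega

/-- The permutation `φ_{4n+2} := β_{2n+1} |⋄ e_{2n+1}` belongs to `Sim(4n+2)`; in particular it is a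
`(4n+2)`-cycle. -/
theorem phi_isSim (n : ℕ) (hn : 1 ≤ n) (β : Equiv.Perm (Fin (2 * n + 1)))
    (h : ∀ i : Fin (2 * n + 1), (β i : ℕ) = stefanBetaFun n i) :
    IsSim n ((finCongr (show (2 * n + 1) + (2 * n + 1) = 4 * n + 2 by ring)).permCongr
      (lpaste β (1 : Equiv.Perm (Fin (2 * n + 1))))) := by
  have val : ∀ i : Fin (4 * n + 2),
      ((finCongr (show (2 * n + 1) + (2 * n + 1) = 4 * n + 2 by ring)).permCongr
        (lpaste β (1 : Equiv.Perm (Fin (2 * n + 1)))) i : ℕ) =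
      if (i : ℕ) < 2 * n + 1 then stefanBetaFun n i + (2 * n + 1) else i - (2 * n + 1) := by
    intro i
    simp [Equiv.permCongr_apply, lpaste_one_val, h]
  refine isSim_of_stefanBetaFun _ (fun i hi => ?_) (fun i hi => ?_)
  · rw [val, if_pos hi]
  · rw [val, if_neg (by omega)]
end
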